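/- arXiv:2006.16227 — 5 statements merged into one kernel-verified Lean document; each statement's English description precedes it below -/
import Mathlib

section
/- Let n ≥ 1 be a natural number and α, β ∈ (1,∞) real numbers with n/α + 2/β = 2. Let T ∈ ℝ, t < T, r > 0 with r² ≤ T − t, a ∈ (0, 1/√2], and set I := (t − a²r², t + a²r²). Let ν : ℝ → [0,∞) be measurable with κ·(a r)ⁿ ≤ ν(s) ≤ C·(a r)ⁿ for all s ∈ I (with 0 ≤ κ and 0 ≤ C). Then (2/3)·κ^{1/α}·a²·r²/(T−t) ≤ ( ∫_I (T−s)^{−β}·ν(s)^{β/α} ds )^{1/β} ≤ 4·C^{1/α}·a²·r²/(T−t). -/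
open MeasureTheory

/-- The `L^β`-type mean over an interval of length `2ρ²` of the constant `c⁻¹ (K ρⁿ)^(1/α)`,
for an optimal pair `(α, β)`. -/
theorem rpow_const_integral_of_optimal {n : ℕ} {α β : ℝ} (hβ : 0 < β)
    (hopt : (n : ℝ) / α + 2 / β = 2) {c K ρ : ℝ} (hc : 0 < c) (hK : 0 ≤ K) (hρ : 0 < ρ) :
    (2 * ρ ^ 2 * (c ^ (-β) * (K * ρ ^ n) ^ (β / α))) ^ (1 / β) =
      (2 : ℝ) ^ (1 / β) * (c⁻¹ * K ^ (1 / α) * ρ ^ 2) := by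
  have hc' : (c ^ (-β)) ^ (1 / β) = c⁻¹ := by
    rw [← Real.rpow_mul hc.le, show -β * (1 / β) = -1 by field_simp, Real.rpow_neg_one]
  have hK' : (K ^ (β / α)) ^ (1 / β) = K ^ (1 / α) := by
    rw [← Real.rpow_mul hK]
    congr 1
    field_simp
  have hρ' : (ρ ^ 2) ^ (1 / β) * ((ρ ^ n) ^ (β / α)) ^ (1 / β) = ρ ^ 2 := by
    rw [← Real.rpow_natCast ρ n, ← Real.rpow_natCast ρ 2, ← Real.rpow_mul hρ.le,
      ← Real.rpow_mul hρ.le, ← Real.rpow_mul hρ.le, ← Real.rpow_add hρ]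
    congr 1
    have h : (n : ℝ) * (β / α) * (1 / β) = n / α := by field_simp
    rw [h]
    push_cast
    linear_combination hopt
  rw [Real.mul_rpow hK (by positivity), Real.mul_rpow (by positivity) (by positivity),
    Real.mul_rpow (by norm_num) (by positivity), Real.mul_rpow (by positivity) (by positivity),
    Real.mul_rpow (by positivity) (by positivity), hc', hK']
  linear_combination (2 : ℝ) ^ (1 / β) * c⁻¹ * K ^ (1 / α) * hρ'

/-- Abstract computational core of the integral classification of singular sets:
for an optimal pair `(α,β)`, with `r² ≤ T - t`, `a ≤ 1/√2`, `I = (t - a²r², t + a²r²)`,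
and `ν` pinned between `κ(ar)ⁿ` and `C(ar)ⁿ` on `I`, the quantity
`(∫_I (T-s)^{-β} ν(s)^{β/α} ds)^{1/β}` is pinned between `(2/3)κ^{1/α}a²r²/(T-t)` and
`4C^{1/α}a²r²/(T-t)`. -/
theorem stmt_5 (n : ℕ) (hn : 1 ≤ n) (α β : ℝ) (hα : 1 < α) (hβ : 1 < β)
    (hopt : (n : ℝ) / α + 2 / β = 2)
    (T t r : ℝ) (ht : t < T) (hr : 0 < r) (hrT : r ^ 2 ≤ T - t)
    (a : ℝ) (ha : a ∈ Set.Ioc (0:ℝ) (1 / Real.sqrt 2))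
    (I : Set ℝ) (hI : I = Set.Ioo (t - a ^ 2 * r ^ 2) (t + a ^ 2 * r ^ 2))
    (ν : ℝ → ℝ) (hν : Measurable ν) (hν0 : ∀ s, 0 ≤ ν s)
    (κ C : ℝ) (hκ : 0 ≤ κ) (hC : 0 ≤ C)
    (hb : ∀ s ∈ I, κ * (a * r) ^ n ≤ ν s ∧ ν s ≤ C * (a * r) ^ n) :
    2 / 3 * κ ^ (1 / α) * a ^ 2 * r ^ 2 / (T - t) ≤
      (∫ s in I, (T - s) ^ (-β) * ν s ^ (β / α)) ^ (1 / β) ∧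
    (∫ s in I, (T - s) ^ (-β) * ν s ^ (β / α)) ^ (1 / β) ≤
      4 * C ^ (1 / α) * a ^ 2 * r ^ 2 / (T - t) := by
  obtain ⟨ha0, ha1⟩ := ha
  have hβ0 : 0 < β := by linarith
  have hβα : 0 ≤ β / α := by positivity
  have hD : 0 < T - t := sub_pos.2 ht
  have hρ : 0 < a * r := mul_pos ha0 hr
  have ha2 : a ^ 2 ≤ 1 / 2 := by
    calc a ^ 2 ≤ (1 / Real.sqrt 2) ^ 2 := by gcongr
      _ = 1 / 2 := by rw [div_pow, Real.sq_sqrt (by norm_num), one_pow]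
  have hL : a ^ 2 * r ^ 2 ≤ (T - t) / 2 := by nlinarith [sq_nonneg r]
  have hs : ∀ s ∈ I, (T - t) / 2 ≤ T - s ∧ T - s ≤ 3 * (T - t) / 2 := by
    intro s hs
    rw [hI] at hs
    constructor <;> linarith [hs.1, hs.2]
  have hIm : MeasurableSet I := hI ▸ measurableSet_Ioo
  have hvol : volume.real I = 2 * (a * r) ^ 2 := by
    rw [hI, Real.volume_real_Ioo_of_le (by nlinarith [sq_nonneg (a * r)])]
    ring
  have hfin : volume I ≠ ⊤ := by rw [hI]; exact measure_Ioo_lt_top.ne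
  set f : ℝ → ℝ := fun s => (T - s) ^ (-β) * ν s ^ (β / α) with hf
  have hfm : Measurable f := by
    simp only [hf]
    fun_prop
  have hlow : ∀ s ∈ I, (3 * (T - t) / 2) ^ (-β) * (κ * (a * r) ^ n) ^ (β / α) ≤ f s := by
    intro s hsI
    have h0 : 0 < T - s := by linarith [(hs s hsI).1]
    exact mul_le_mul (Real.rpow_le_rpow_of_nonpos h0 (hs s hsI).2 (by linarith))
      (Real.rpow_le_rpow (by positivity) (hb s hsI).1 hβα) (by positivity) (by positivity)
  have hup : ∀ s ∈ I, f s ≤ ((T - t) / 2) ^ (-β) * (C * (a * r) ^ n) ^ (β / α) := by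
    intro s hsI
    exact mul_le_mul (Real.rpow_le_rpow_of_nonpos (by positivity) (hs s hsI).1 (by linarith))
      (Real.rpow_le_rpow (hν0 s) (hb s hsI).2 hβα) (Real.rpow_nonneg (hν0 s) _) (by positivity)
  have hnonneg : ∀ s ∈ I, 0 ≤ f s := fun s hsI => le_trans (by positivity) (hlow s hsI)
  have hconst : ∀ c : ℝ, IntegrableOn (fun _ => c) I volume := fun c => integrableOn_const hfin
  have hint : IntegrableOn f I volume := by
    refine (hconst (((T - t) / 2) ^ (-β) * (C * (a * r) ^ n) ^ (β / α))).mono'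
      hfm.aestronglyMeasurable ((ae_restrict_iff' hIm).2 (.of_forall fun s hsI => ?_))
    rw [Real.norm_of_nonneg (hnonneg s hsI)]
    exact hup s hsI
  have hlower := setIntegral_mono_on (hconst _) hint hIm hlow
  have hupper := setIntegral_mono_on hint (hconst _) hIm hup
  rw [setIntegral_const, smul_eq_mul, hvol] at hlower hupper
  have h1 : 1 ≤ (2 : ℝ) ^ (1 / β) := Real.one_le_rpow (by norm_num) (by positivity)
  have h2 : (2 : ℝ) ^ (1 / β) ≤ 2 := by
    simpa using Real.rpow_le_rpow_of_exponent_le (x := 2) (by norm_num)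
      ((div_le_one hβ0).2 hβ.le)
  constructor
  · calc 2 / 3 * κ ^ (1 / α) * a ^ 2 * r ^ 2 / (T - t)
        = 1 * ((3 * (T - t) / 2)⁻¹ * κ ^ (1 / α) * (a * r) ^ 2) := by field_simp
      _ ≤ (2 : ℝ) ^ (1 / β) * ((3 * (T - t) / 2)⁻¹ * κ ^ (1 / α) * (a * r) ^ 2) := by gcongr
      _ = _ := (rpow_const_integral_of_optimal hβ0 hopt (by positivity) hκ hρ).symm
      _ ≤ _ := Real.rpow_le_rpow (by positivity) hlower (by positivity)
  · calc (∫ s in I, f s) ^ (1 / β) ≤ _ :=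
          Real.rpow_le_rpow (setIntegral_nonneg hIm hnonneg) hupper (by positivity)
      _ = (2 : ℝ) ^ (1 / β) * (((T - t) / 2)⁻¹ * C ^ (1 / α) * (a * r) ^ 2) :=
        rpow_const_integral_of_optimal hβ0 hopt (by positivity) hC hρ
      _ ≤ 2 * (((T - t) / 2)⁻¹ * C ^ (1 / α) * (a * r) ^ 2) := by gcongr
      _ = 4 * C ^ (1 / α) * a ^ 2 * r ^ 2 / (T - t) := by
        field_simp
        ring
end

section
/- Let (X, μ) be a measure space, B ⊆ X a measurable set, n a natural number, r' ∈ (0,1), ε ∈ (0,1), and set α := 4 − 2ε and d' := 4 − ε. Let K₁ ≥ 0 and E' ≥ 0, and let ρ : X → (0,∞) be measurable. Assume μ(B) ≤ K₁·(r')ⁿ and μ({x ∈ B : ρ(x) < s·r'}) ≤ E'·s^{d'}·(r')ⁿ for all s ∈ (0,1]. Then ∫_B ρ(x)^{−α} dμ(x) ≤ (K₁ + E'·α/ε)·(r')^{n−4+2ε}. -/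
open MeasureTheory

lemma lintegral_Ioc_zero_one_rpow {a : ℝ} (ha : 0 < a) :
    ∫⁻ t in Set.Ioc (0 : ℝ) 1, ENNReal.ofReal (t ^ (a - 1)) = ENNReal.ofReal (1 / a) := by
  have hint := intervalIntegral.intervalIntegrable_rpow' (a := 0) (b := 1)
    (show -1 < a - 1 by linarith)
  rw [intervalIntegrable_iff_integrableOn_Ioc_of_le zero_le_one] at hint
  rw [← ofReal_integral_eq_lintegral_ofReal hint, ← intervalIntegral.integral_of_le zero_le_one,
    integral_rpow (Or.inl (by linarith))]
  · simp [ha.ne']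
  · filter_upwards [ae_restrict_mem measurableSet_Ioc] with t ht
    exact Real.rpow_nonneg ht.1.le _

lemma lintegral_Ioi_one_rpow {ε : ℝ} (hε : 0 < ε) :
    ∫⁻ t in Set.Ioi (1 : ℝ), ENNReal.ofReal (t ^ (-ε - 1)) = ENNReal.ofReal (1 / ε) := by
  have hlt : -ε - 1 < -1 := by linarith
  rw [← ofReal_integral_eq_lintegral_ofReal (integrableOn_Ioi_rpow_of_lt hlt one_pos),
    integral_Ioi_rpow_of_lt hlt one_pos]
  · simp
  · filter_upwards [ae_restrict_mem measurableSet_Ioi] with t ht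
    exact Real.rpow_nonneg (zero_le_one.trans (le_of_lt ht)) _

/-- Layer-cake bound for a nonnegative function whose superlevel sets have measure at most `a`
below level `1` and decay like `b * t ^ (-(p + ε))` above it. -/
lemma lintegral_rpow_le_of_meas_lt_le {X : Type*} [MeasurableSpace X] {μ : Measure X}
    {f : X → ℝ} (hf : Measurable f) (hf0 : ∀ x, 0 ≤ f x) {p ε a b : ℝ} (hp : 0 < p) (hε : 0 < ε)
    (ha : 0 ≤ a) (hb : 0 ≤ b) (hμ : μ Set.univ ≤ ENNReal.ofReal a)
    (htail : ∀ t, 1 < t → μ {x | t < f x} ≤ ENNReal.ofReal (b * t ^ (-(p + ε)))) :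
    ∫⁻ x, ENNReal.ofReal (f x ^ p) ∂μ ≤ ENNReal.ofReal (a + b * p / ε) := by
  rw [lintegral_rpow_eq_lintegral_meas_lt_mul μ (ae_of_all _ hf0) hf.aemeasurable hp,
    ← Set.Ioc_union_Ioi_eq_Ioi zero_le_one]
  have hlow : ∫⁻ t in Set.Ioc (0 : ℝ) 1, μ {x | t < f x} * ENNReal.ofReal (t ^ (p - 1)) ≤
      ENNReal.ofReal (a * (1 / p)) := by
    rw [ENNReal.ofReal_mul ha, ← lintegral_Ioc_zero_one_rpow hp,
      ← lintegral_const_mul' _ _ ENNReal.ofReal_ne_top]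
    exact lintegral_mono fun t ↦ by
      gcongr
      exact (measure_mono (Set.subset_univ _)).trans hμ
  have hhigh : ∫⁻ t in Set.Ioi (1 : ℝ), μ {x | t < f x} * ENNReal.ofReal (t ^ (p - 1)) ≤
      ENNReal.ofReal (b * (1 / ε)) := by
    rw [ENNReal.ofReal_mul hb, ← lintegral_Ioi_one_rpow hε,
      ← lintegral_const_mul' _ _ ENNReal.ofReal_ne_top]
    refine setLIntegral_mono' measurableSet_Ioi fun t (ht : 1 < t) ↦ ?_
    have ht0 : 0 < t := one_pos.trans ht
    calc μ {x | t < f x} * ENNReal.ofReal (t ^ (p - 1))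
        ≤ ENNReal.ofReal (b * t ^ (-(p + ε))) * ENNReal.ofReal (t ^ (p - 1)) := by
          gcongr
          exact htail t ht
      _ = ENNReal.ofReal b * ENNReal.ofReal (t ^ (-ε - 1)) := by
          rw [← ENNReal.ofReal_mul (by positivity), ← ENNReal.ofReal_mul hb, mul_assoc,
            ← Real.rpow_add ht0]
          ring_nf
  calc ENNReal.ofReal p * ∫⁻ t in Set.Ioc (0 : ℝ) 1 ∪ Set.Ioi 1,
        μ {x | t < f x} * ENNReal.ofReal (t ^ (p - 1))
      ≤ ENNReal.ofReal p * (ENNReal.ofReal (a * (1 / p)) + ENNReal.ofReal (b * (1 / ε))) := by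
        gcongr
        exact (lintegral_union_le _ _ _).trans (add_le_add hlow hhigh)
    _ = ENNReal.ofReal (a + b * p / ε) := by
        rw [← ENNReal.ofReal_add (by positivity) (by positivity), ← ENNReal.ofReal_mul hp.le]
        congr 1
        field_simp

/-- Layer-cake estimate: a volume bound on the set `B` together with sublevel-set volume
bounds for `ρ` on `B` yields an `L^{4-2ε}` bound for `ρ⁻¹` on `B`. -/
theorem stmt_6 {X : Type*} [MeasurableSpace X] (μ : Measure X)
    (B : Set X) (hB : MeasurableSet B) (n : ℕ)
    (r' : ℝ) (hr' : r' ∈ Set.Ioo (0:ℝ) 1) (ε : ℝ) (hε : ε ∈ Set.Ioo (0:ℝ) 1)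
    (α d' : ℝ) (hαdef : α = 4 - 2 * ε) (hd'def : d' = 4 - ε)
    (K₁ E' : ℝ) (hK : 0 ≤ K₁) (hE : 0 ≤ E')
    (ρ : X → ℝ) (hρpos : ∀ x, 0 < ρ x) (hρm : Measurable ρ)
    (hμB : μ B ≤ ENNReal.ofReal (K₁ * r' ^ n))
    (hsub : ∀ s ∈ Set.Ioc (0:ℝ) 1,
      μ {x ∈ B | ρ x < s * r'} ≤ ENNReal.ofReal (E' * s ^ d' * r' ^ n)) :
    ∫⁻ x in B, ENNReal.ofReal (ρ x ^ (-α)) ∂μ ≤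
      ENNReal.ofReal ((K₁ + E' * α / ε) * r' ^ ((n : ℝ) - 4 + 2 * ε)) := by
  obtain ⟨hr0, -⟩ := hr'
  obtain ⟨hε0, hε1⟩ := hε
  have hα : 0 < α := by linarith
  have htail : ∀ t, 1 < t → μ.restrict B {x | t < r' / ρ x} ≤
      ENNReal.ofReal (E' * r' ^ n * t ^ (-(α + ε))) := by
    intro t ht
    have ht0 : 0 < t := one_pos.trans ht
    rw [Measure.restrict_apply' hB]
    refine (measure_mono fun x hx ↦ ?_).trans
      ((hsub t⁻¹ ⟨inv_pos.2 ht0, inv_le_one_of_one_le₀ ht.le⟩).trans_eq ?_)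
    · refine ⟨hx.2, ?_⟩
      have h := (lt_div_iff₀ (hρpos x)).1 hx.1
      rwa [inv_mul_eq_div, lt_div_iff₀' ht0]
    · rw [Real.inv_rpow ht0.le, ← Real.rpow_neg ht0.le, hαdef, hd'def]
      ring_nf
  have key := lintegral_rpow_le_of_meas_lt_le (μ := μ.restrict B) (f := fun x ↦ r' / ρ x)
    (a := K₁ * r' ^ n) (b := E' * r' ^ n) (by fun_prop)
    (fun x ↦ (div_pos hr0 (hρpos x)).le) hα hε0 (by positivity) (by positivity)
    (by rwa [Measure.restrict_apply_univ]) htail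
  calc ∫⁻ x in B, ENNReal.ofReal (ρ x ^ (-α)) ∂μ
      = ENNReal.ofReal (r' ^ (-α)) * ∫⁻ x in B, ENNReal.ofReal ((r' / ρ x) ^ α) ∂μ := by
        rw [← lintegral_const_mul' _ _ ENNReal.ofReal_ne_top]
        refine lintegral_congr fun x ↦ ?_
        rw [← ENNReal.ofReal_mul (by positivity), Real.div_rpow hr0.le (hρpos x).le,
          Real.rpow_neg hr0.le, Real.rpow_neg (hρpos x).le]
        congr 1
        field_simp
    _ ≤ ENNReal.ofReal (r' ^ (-α)) * ENNReal.ofReal (K₁ * r' ^ n + E' * r' ^ n * α / ε) := by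
        gcongr
    _ = ENNReal.ofReal ((K₁ + E' * α / ε) * r' ^ ((n : ℝ) - 4 + 2 * ε)) := by
        rw [← ENNReal.ofReal_mul (by positivity),
          show (n : ℝ) - 4 + 2 * ε = n + -α by rw [hαdef]; ring,
          Real.rpow_add hr0, Real.rpow_natCast]
        congr 1
        ring
end

section
/- Let T ∈ ℝ, c ∈ (0,1), and let (t_i)_{i ∈ ℕ} be a strictly increasing sequence of reals with t_i < T for all i and t_i → T. Assume that for every i ≥ 1 one has T − t_{i−1} < ((1+c)/(1−c))·(T − t_i). Then the union of the open intervals ⋃_{i ∈ ℕ} (t_i − c·(T − t_i), t_i + c·(T − t_i)) contains the interval [t₀, T). -/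
/-- Interval covering lemma: if `t_i ↗ T` with `T - t_{i-1} < ((1+c)/(1-c))(T - t_i)` for all
`i ≥ 1`, then the union of the intervals `(t_i - c(T-t_i), t_i + c(T-t_i))` covers `[t₀, T)`. -/
theorem stmt_8 (T c : ℝ) (hc : c ∈ Set.Ioo (0:ℝ) 1)
    (t : ℕ → ℝ) (hmono : StrictMono t) (hlt : ∀ i, t i < T)
    (hlim : Filter.Tendsto t Filter.atTop (nhds T))
    (hrate : ∀ i : ℕ, 1 ≤ i → T - t (i - 1) < (1 + c) / (1 - c) * (T - t i)) :
    Set.Ico (t 0) T ⊆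
      ⋃ i : ℕ, Set.Ioo (t i - c * (T - t i)) (t i + c * (T - t i)) := by
  obtain ⟨hc0, hc1⟩ := hc
  rintro x ⟨hx0, hxT⟩
  have hex : ∃ n, x < t n := (hlim.eventually (lt_mem_nhds hxT)).exists
  classical
  obtain ⟨n, hn, hmin⟩ : ∃ n, x < t n ∧ ∀ m < n, ¬ x < t m :=
    ⟨Nat.find hex, Nat.find_spec hex, fun m hm => Nat.find_min hex hm⟩
  have hn1 : 1 ≤ n := by
    rcases Nat.eq_zero_or_pos n with rfl | h
    · exact absurd hn (not_lt.mpr hx0)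
    · exact h
  have hprev : t (n - 1) ≤ x := not_lt.mp (hmin (n - 1) (by omega))
  have hr := hrate n hn1
  rw [div_mul_eq_mul_div, lt_div_iff₀ (by linarith)] at hr
  have hpos := mul_pos hc0 (sub_pos.mpr (hlt n))
  have hpos' := mul_pos hc0 (sub_pos.mpr (hlt (n - 1)))
  rw [Set.mem_iUnion]
  rcases lt_or_ge (t n - c * (T - t n)) x with h | h
  · exact ⟨n, h, by linarith⟩
  · exact ⟨n - 1, by linarith, by linarith⟩
end

section
/- Let (X,d) be a metric space, C ≥ 0, and let ρ : X × ℝ → ℝ be positive and satisfy |ρ(p,t) − ρ(q,s)| ≤ d(p,q) + C·|t−s|^{1/2} for all p, q ∈ X and s, t ∈ ℝ. Set a := 1/(2(1+C)). Let T ∈ ℝ, m > 0 with m²·a² < 1, p ∈ X, and let (t_i)_{i ∈ ℕ} be a strictly increasing sequence with t_i < T, t_i → T, and T − t_{i−1} < ((1+m²a²)/(1−m²a²))·(T − t_i) for all i ≥ 1, and let (p_i)_{i ∈ ℕ} be points of X with d(p, p_i) ≤ a·m·√(T − t_i) and ρ(p_i, t_i) ≥ m·√(T − t_i) for all i. Then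 for every ξ ∈ [t₀, T) one has ρ(p, ξ)² ≥ (m²/4)·(T − ξ)/(1 + m²a²). -/
/-- A lower bound `m√(T - s)` for `ρ` at `(q, s)` propagates to `(p, ξ)` whenever `q` is within
`a m √(T - s)` of `p` and `ξ` is within `m² a² (T - s)` of `s`. -/
theorem sq_lower_bound_of_parabolic_modulus {X : Type*} [MetricSpace X] {C : ℝ} (hC : 0 ≤ C)
    {ρ : X → ℝ → ℝ}
    (hmod : ∀ p q t s, |ρ p t - ρ q s| ≤ dist p q + C * Real.sqrt |t - s|)
    {a : ℝ} (ha : a = 1 / (2 * (1 + C))) {T m s ξ : ℝ} (hm : 0 < m) (hs : s < T) {p q : X}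
    (hdist : dist p q ≤ a * m * Real.sqrt (T - s)) (hρ : m * Real.sqrt (T - s) ≤ ρ q s)
    (hξ : |ξ - s| ≤ m ^ 2 * a ^ 2 * (T - s)) :
    m ^ 2 / 4 * ((T - ξ) / (1 + m ^ 2 * a ^ 2)) ≤ ρ p ξ ^ 2 := by
  have ha0 : 0 < a := by rw [ha]; positivity
  have haC : a + C * a = 1 / 2 := by rw [ha]; field_simp
  have hsqrt : Real.sqrt |ξ - s| ≤ m * a * Real.sqrt (T - s) := by
    calc Real.sqrt |ξ - s| ≤ Real.sqrt ((m * a) ^ 2 * (T - s)) :=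
          Real.sqrt_le_sqrt (by rwa [mul_pow])
      _ = m * a * Real.sqrt (T - s) := by
          rw [Real.sqrt_mul (sq_nonneg _), Real.sqrt_sq (by positivity)]
  have hlow : m / 2 * Real.sqrt (T - s) ≤ ρ p ξ := by
    have h1 := (abs_le.mp (hmod p q ξ s)).1
    have h2 := mul_le_mul_of_nonneg_left hsqrt hC
    have h3 : a * m * Real.sqrt (T - s) + C * (m * a * Real.sqrt (T - s))
        = m / 2 * Real.sqrt (T - s) := by
      linear_combination m * Real.sqrt (T - s) * haC
    linarith
  have hratio : (T - ξ) / (1 + m ^ 2 * a ^ 2) ≤ T - s := by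
    rw [div_le_iff₀ (by positivity)]
    linarith [(abs_le.mp hξ).1]
  calc m ^ 2 / 4 * ((T - ξ) / (1 + m ^ 2 * a ^ 2)) ≤ m ^ 2 / 4 * (T - s) := by gcongr
    _ = (m / 2 * Real.sqrt (T - s)) ^ 2 := by
        rw [mul_pow, Real.sq_sqrt (by linarith)]; ring
    _ ≤ ρ p ξ ^ 2 := by gcongr

/-- Abstract form of Proposition 2.9: if a positive function `ρ` with parabolic
Lipschitz–Hölder modulus (constant `C`, `a = 1/(2(1+C))`) satisfies a Type I lower bound
`ρ(p_i,t_i) ≥ m√(T-t_i)` along a sequence converging to `(p,T)` linearly in time and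
parabolically in space, then `ρ(p,ξ)² ≥ (m²/4)(T-ξ)/(1+m²a²)` for all `ξ ∈ [t₀, T)`. -/
theorem stmt_9 {X : Type*} [MetricSpace X] (C : ℝ) (hC : 0 ≤ C)
    (ρ : X → ℝ → ℝ) (hpos : ∀ p t, 0 < ρ p t)
    (hmod : ∀ p q t s, |ρ p t - ρ q s| ≤ dist p q + C * Real.sqrt |t - s|)
    (a : ℝ) (ha : a = 1 / (2 * (1 + C)))
    (T m : ℝ) (hm : 0 < m) (hma : m ^ 2 * a ^ 2 < 1) (p : X)
    (t : ℕ → ℝ) (hmono : StrictMono t) (hlt : ∀ i, t i < T)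
    (hlim : Filter.Tendsto t Filter.atTop (nhds T))
    (hrate : ∀ i : ℕ, 1 ≤ i →
      T - t (i - 1) < (1 + m ^ 2 * a ^ 2) / (1 - m ^ 2 * a ^ 2) * (T - t i))
    (pt : ℕ → X)
    (hdist : ∀ i, dist p (pt i) ≤ a * m * Real.sqrt (T - t i))
    (hρ : ∀ i, m * Real.sqrt (T - t i) ≤ ρ (pt i) (t i)) :
    ∀ ξ ∈ Set.Ico (t 0) T, m ^ 2 / 4 * ((T - ξ) / (1 + m ^ 2 * a ^ 2)) ≤ ρ p ξ ^ 2 := by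
  rintro ξ ⟨h0, hξT⟩
  have hex : ∃ n, ξ < t n := (hlim.eventually (lt_mem_nhds hξT)).exists
  classical
  obtain ⟨i, hi⟩ : ∃ i, Nat.find hex = i + 1 :=
    Nat.exists_eq_succ_of_ne_zero fun h => absurd (h ▸ Nat.find_spec hex) h0.not_gt
  have hnext : ξ < t (i + 1) := hi ▸ Nat.find_spec hex
  have hprev : t i ≤ ξ := not_lt.mp (Nat.find_min hex (by omega))
  by_cases hcase : ξ - t i ≤ m ^ 2 * a ^ 2 * (T - t i)
  · refine sq_lower_bound_of_parabolic_modulus hC hmod ha hm (hlt i) (hdist i) (hρ i) ?_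
    rwa [abs_of_nonneg (by linarith)]
  · refine sq_lower_bound_of_parabolic_modulus hC hmod ha hm (hlt _) (hdist (i + 1))
      (hρ (i + 1)) ?_
    have hr := hrate (i + 1) (by omega)
    rw [Nat.add_sub_cancel, div_mul_eq_mul_div, lt_div_iff₀ (by linarith)] at hr
    rw [abs_of_neg (by linarith)]
    linarith
end

section
/- Let T > 0 and define f : [0,T) → ℝ by f(t) = (T−t)² + (T−t)·|sin(log(T−t))|. Then f is Lipschitz on [0,T) with Lipschitz constant 2T + 2, and for every natural number k with exp(−kπ) ≤ T one has f(T − exp(−kπ)) = exp(−2kπ) = (T − t_k)² where t_k := T − exp(−kπ). -/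
theorem abs_mul_sin_log_sub_le {x y : ℝ} (hx : 0 < x) (hy : 0 < y) :
    |x * Real.sin (Real.log x) - y * Real.sin (Real.log y)| ≤ 2 * |x - y| := by
  have hderiv : ∀ z ∈ Set.Ioi (0 : ℝ),
      HasDerivWithinAt (fun z => z * Real.sin (Real.log z))
        (Real.sin (Real.log z) + Real.cos (Real.log z)) (Set.Ioi 0) z := by
    intro z hz
    have hz' : z ≠ 0 := ne_of_gt hz
    have h := (hasDerivAt_id' z).mul (Real.hasDerivAt_log hz').sin
    refine (h.congr_deriv ?_).hasDerivWithinAt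
    rw [one_mul, mul_left_comm, mul_inv_cancel₀ hz', mul_one]
  have hbound : ∀ z ∈ Set.Ioi (0 : ℝ),
      ‖Real.sin (Real.log z) + Real.cos (Real.log z)‖ ≤ 2 := by
    intro z _
    rw [Real.norm_eq_abs]
    linarith [abs_add_le (Real.sin (Real.log z)) (Real.cos (Real.log z)),
      Real.abs_sin_le_one (Real.log z), Real.abs_cos_le_one (Real.log z)]
  exact (convex_Ioi (0 : ℝ)).norm_image_sub_le_of_norm_hasDerivWithin_le hderiv hbound hy hx

/-- The explicit oscillating example `f(t) = (T-t)² + (T-t)|sin(log(T-t))|` is Lipschitz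
on `[0,T)` with constant `2T+2` and equals `(T-t_k)²` at `t_k = T - exp(-kπ)`. -/
theorem stmt_12 (T : ℝ) (hT : 0 < T)
    (f : ℝ → ℝ)
    (hf : ∀ t, f t = (T - t) ^ 2 + (T - t) * |Real.sin (Real.log (T - t))|) :
    (∀ s ∈ Set.Ico (0:ℝ) T, ∀ u ∈ Set.Ico (0:ℝ) T,
      |f s - f u| ≤ (2 * T + 2) * |s - u|) ∧
    (∀ k : ℕ, Real.exp (-(k:ℝ) * Real.pi) ≤ T →
      f (T - Real.exp (-(k:ℝ) * Real.pi)) = Real.exp (-2 * (k:ℝ) * Real.pi) ∧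
      Real.exp (-2 * (k:ℝ) * Real.pi) = (T - (T - Real.exp (-(k:ℝ) * Real.pi))) ^ 2) := by
  constructor
  · rintro s ⟨hs0, hsT⟩ u ⟨hu0, huT⟩
    have hx : 0 < T - s := sub_pos.2 hsT
    have hy : 0 < T - u := sub_pos.2 huT
    have hsub : |(T - s) - (T - u)| = |s - u| := by
      rw [sub_sub_sub_cancel_left, abs_sub_comm]
    have hsq : |(T - s) ^ 2 - (T - u) ^ 2| ≤ 2 * T * |s - u| := by
      rw [sq_sub_sq, abs_mul, hsub]
      gcongr
      rw [abs_of_pos (by linarith)]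
      linarith
    have hosc : |(T - s) * |Real.sin (Real.log (T - s))|
        - (T - u) * (|Real.sin (Real.log (T - u))|)| ≤ 2 * |s - u| := by
      rw [← hsub]
      refine le_trans ?_ (abs_mul_sin_log_sub_le hx hy)
      have h := abs_abs_sub_abs_le ((T - s) * Real.sin (Real.log (T - s)))
        ((T - u) * Real.sin (Real.log (T - u)))
      rwa [abs_mul, abs_mul, abs_of_pos hx, abs_of_pos hy] at h
    rw [hf, hf, add_sub_add_comm, add_mul]
    exact (abs_add_le _ _).trans (add_le_add hsq hosc)
  · intro k _
    have hexp : Real.exp (-2 * (k:ℝ) * Real.pi) = Real.exp (-(k:ℝ) * Real.pi) ^ 2 := by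
      rw [← Real.exp_nat_mul]
      congr 1
      push_cast
      ring
    refine ⟨?_, by rw [sub_sub_cancel, hexp]⟩
    rw [hf, sub_sub_cancel, Real.log_exp, hexp, neg_mul, Real.sin_neg, Real.sin_nat_mul_pi]
    simp
end
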